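/- arXiv:2112.11712 — 2 statements merged into one kernel-verified Lean document; each statement's English description precedes it below -/
import Mathlib

section
/- Let G be a simple graph on n vertices and let A ∈ S(G) be a matrix with the strong multiplicity property (SMP). Then for every integer q' with q(A) ≤ q' ≤ n, there exists a matrix A' ∈ S(G) with the SMP such that q(A') = q'. -/
open Matrix Polynomial

/-- `A` belongs to `S(G)`: symmetric, with off-diagonal nonzero pattern given by `G`. -/
def sMem {n : ℕ} (G : SimpleGraph (Fin n)) (A : Matrix (Fin n) (Fin n) ℝ) : Prop :=
  A.IsSymm ∧ ∀ i j, i ≠ j → (A i j ≠ 0 ↔ G.Adj i j)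

/-- The number of distinct (real) eigenvalues of `A`. -/
noncomputable def qDist {n : ℕ} (A : Matrix (Fin n) (Fin n) ℝ) : ℕ :=
  A.charpoly.roots.toFinset.card

/-- The strong multiplicity property. -/
def HasSMP {n : ℕ} (A : Matrix (Fin n) (Fin n) ℝ) : Prop :=
  ∀ X : Matrix (Fin n) (Fin n) ℝ, X.IsSymm →
    (∀ i j, A i j * X i j = 0) → (∀ i, X i i = 0) → A * X = X * A →
    (∀ k < qDist A, Matrix.trace (A ^ k * X) = 0) → X = 0

open Filter Topology

/-- Twice the symmetric part of a matrix, restricted to the off-diagonal non-edges of `G`. -/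
noncomputable def nonEdgePart {n : ℕ} (G : SimpleGraph (Fin n)) :
    Matrix (Fin n) (Fin n) ℝ →ₗ[ℝ] Matrix (Fin n) (Fin n) ℝ := by
  classical
  exact
    { toFun := fun X => Matrix.of fun i j => if i ≠ j ∧ ¬ G.Adj i j then X i j + X j i else 0
      map_add' := fun X Y => by
        ext i j
        simp only [Matrix.of_apply, Matrix.add_apply]
        split_ifs <;> ring
      map_smul' := fun c X => by
        ext i j
        simp only [Matrix.of_apply, Matrix.smul_apply, smul_eq_mul, RingHom.id_apply]
        split_ifs <;> ring }

open Classical in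
theorem nonEdgePart_apply {n : ℕ} (G : SimpleGraph (Fin n)) (X : Matrix (Fin n) (Fin n) ℝ)
    (i j : Fin n) :
    nonEdgePart G X i j = if i ≠ j ∧ ¬ G.Adj i j then X i j + X j i else 0 := by
  simp only [nonEdgePart, LinearMap.coe_mk, AddHom.coe_mk, Matrix.of_apply]

theorem nonEdgePart_eq_two_smul_iff {n : ℕ} {G : SimpleGraph (Fin n)}
    {A : Matrix (Fin n) (Fin n) ℝ} (hA : sMem G A) (X : Matrix (Fin n) (Fin n) ℝ) :
    nonEdgePart G X = (2 : ℝ) • X ↔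
      X.IsSymm ∧ (∀ i j, A i j * X i j = 0) ∧ ∀ i, X i i = 0 := by
  constructor
  · intro h
    have h' : ∀ i j, nonEdgePart G X i j = 2 * X i j := fun i j => by rw [h]; simp
    simp only [nonEdgePart_apply] at h'
    refine ⟨Matrix.IsSymm.ext fun i j => ?_, fun i j => ?_, fun i => ?_⟩
    · have h1 := h' i j
      have h2 := h' j i
      by_cases hc : i ≠ j ∧ ¬ G.Adj i j
      · rw [if_pos hc] at h1
        rw [if_pos ⟨hc.1.symm, fun h => hc.2 h.symm⟩] at h2
        linarith
      · rw [if_neg hc] at h1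
        rw [if_neg fun h => hc ⟨h.1.symm, fun h0 => h.2 h0.symm⟩] at h2
        linarith
    · rcases eq_or_ne i j with rfl | hij
      · have := h' i i
        simp at this
        simp [this]
      · by_cases hadj : G.Adj i j
        · have := h' i j
          simp [hadj] at this
          simp [this]
        · have : A i j = 0 := by
            by_contra h0
            exact hadj ((hA.2 i j hij).1 h0)
          simp [this]
    · have := h' i i
      simpa using this
  · rintro ⟨hs, ho, hd⟩
    ext i j
    rw [nonEdgePart_apply, Matrix.smul_apply, smul_eq_mul]
    split_ifs with h
    · rw [hs.apply j i]; ring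
    · rcases eq_or_ne i j with rfl | hij
      · simp [hd]
      · have hadj : G.Adj i j := by
          by_contra h0
          exact h ⟨hij, h0⟩
        have := (hA.2 i j hij).2 hadj
        have h2 := ho i j
        simp_all

theorem nonEdgePart_eq_zero_of_sMem {n : ℕ} {G : SimpleGraph (Fin n)}
    {A : Matrix (Fin n) (Fin n) ℝ} (hA : sMem G A) : nonEdgePart G A = 0 := by
  ext i j
  rw [nonEdgePart_apply]
  split_ifs with h
  · have h1 : A i j = 0 := by
      by_contra h0
      exact h.2 ((hA.2 i j h.1).1 h0)
    simp [hA.1.apply i j, h1]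
  · rfl

theorem eq_zero_of_nonEdgePart_eq_zero {n : ℕ} {G : SimpleGraph (Fin n)}
    {M : Matrix (Fin n) (Fin n) ℝ} (hM : M.IsSymm) (h : nonEdgePart G M = 0) {i j : Fin n}
    (hij : i ≠ j) (hadj : ¬ G.Adj i j) : M i j = 0 := by
  have h1 : nonEdgePart G M i j = 0 := by rw [h]; rfl
  rw [nonEdgePart_apply, if_pos ⟨hij, hadj⟩, hM.apply i j] at h1
  linarith

theorem hasSMP_iff {n : ℕ} {G : SimpleGraph (Fin n)} {A : Matrix (Fin n) (Fin n) ℝ}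
    (hA : sMem G A) :
    HasSMP A ↔ ∀ X : Matrix (Fin n) (Fin n) ℝ, nonEdgePart G X = (2 : ℝ) • X → A * X = X * A →
      (∀ k < qDist A, Matrix.trace (A ^ k * X) = 0) → X = 0 := by
  simp only [nonEdgePart_eq_two_smul_iff hA, HasSMP, and_imp]

theorem exists_trace_representation {n : ℕ} (g : Matrix (Fin n) (Fin n) ℝ →ₗ[ℝ] ℝ) :
    ∃ X : Matrix (Fin n) (Fin n) ℝ,
      (∀ i j, X i j = g (Matrix.single j i 1)) ∧ ∀ M, g M = Matrix.trace (X * M) := by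
  refine ⟨Matrix.of fun i j => g (Matrix.single j i 1), fun i j => rfl, fun M => ?_⟩
  conv_lhs => rw [Matrix.matrix_eq_sum_single M]
  simp only [map_sum, Matrix.trace, Matrix.diag, Matrix.mul_apply, Matrix.of_apply]
  rw [Finset.sum_comm]
  refine Finset.sum_congr rfl fun i _ => Finset.sum_congr rfl fun j _ => ?_
  rw [show Matrix.single j i (M j i) = M j i • Matrix.single j i (1 : ℝ) by simp, map_smul,
    smul_eq_mul, mul_comm]

/-- The strong multiplicity property makes the isospectral directions `[A, K]`, `K` skew, and the
powers of `A` jointly span the matrices supported on the non-edges. -/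
theorem HasSMP.exists_nonEdgePart_eq {n : ℕ} {G : SimpleGraph (Fin n)}
    {A : Matrix (Fin n) (Fin n) ℝ} (hA : sMem G A) (hsmp : HasSMP A)
    (y : LinearMap.range (nonEdgePart G)) :
    ∃ (K : Matrix (Fin n) (Fin n) ℝ) (c : Fin (qDist A) → ℝ),
      (nonEdgePart G).rangeRestrict
        (A * (K - Kᵀ) - (K - Kᵀ) * A + ∑ k, c k • A ^ (k : ℕ)) = y := by
  let T : Matrix (Fin n) (Fin n) ℝ × (Fin (qDist A) → ℝ) →ₗ[ℝ] Matrix (Fin n) (Fin n) ℝ :=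
    { toFun := fun x => A * (x.1 - x.1ᵀ) - (x.1 - x.1ᵀ) * A + ∑ k, x.2 k • A ^ (k : ℕ)
      map_add' := fun x z => by
        simp only [Prod.fst_add, Prod.snd_add, Pi.add_apply, add_smul, Finset.sum_add_distrib,
          Matrix.transpose_add]
        noncomm_ring
      map_smul' := fun r x => by
        simp only [Prod.smul_fst, Prod.smul_snd, Pi.smul_apply, Matrix.transpose_smul,
          RingHom.id_apply, smul_add, Finset.smul_sum, smul_smul, smul_eq_mul, ← smul_sub,
          Matrix.mul_smul, Matrix.smul_mul] }
  suffices h : LinearMap.range ((nonEdgePart G).rangeRestrict ∘ₗ T) = ⊤ by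
    obtain ⟨x, hx⟩ := LinearMap.range_eq_top.1 h y
    exact ⟨x.1, x.2, hx⟩
  by_contra hne
  obtain ⟨f, hf0, hf⟩ := Submodule.exists_le_ker_of_lt_top _ (lt_top_iff_ne_top.2 hne)
  obtain ⟨X, hX, hg⟩ := exists_trace_representation (f ∘ₗ (nonEdgePart G).rangeRestrict)
  have hT : ∀ K c, Matrix.trace (X * T (K, c)) = 0 := fun K c => by
    rw [← hg]
    exact hf ⟨(K, c), rfl⟩
  have hker : ∀ M, nonEdgePart G M = 0 → Matrix.trace (X * M) = 0 := fun M hM => by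
    rw [← hg, LinearMap.comp_apply,
      show (nonEdgePart G).rangeRestrict M = 0 from Subtype.ext hM, map_zero]
  have hentry : ∀ i j, X i j = Matrix.trace (X * Matrix.single j i 1) := fun i j => by
    rw [hX, hg]
  have hsymm : X.IsSymm := by
    ext i j
    rw [Matrix.transpose_apply, ← sub_eq_zero, hentry j i, hentry i j, ← Matrix.trace_sub,
      ← mul_sub]
    apply hker
    ext a b
    rw [nonEdgePart_apply]
    split_ifs
    · simp only [Matrix.sub_apply, Matrix.single_apply, Matrix.zero_apply, and_comm]
      ring
    · rfl
  have hoff : ∀ i j, ¬ (i ≠ j ∧ ¬ G.Adj i j) → X i j = 0 := fun i j hij => by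
    rw [hentry]
    apply hker
    ext a b
    rw [nonEdgePart_apply]
    split_ifs with hab
    · have h1 : ¬ (j = a ∧ i = b) := by
        rintro ⟨rfl, rfl⟩
        exact hij ⟨hab.1.symm, fun h => hab.2 h.symm⟩
      have h2 : ¬ (j = b ∧ i = a) := by
        rintro ⟨rfl, rfl⟩
        exact hij hab
      simp [h1, h2]
    · rfl
  have hcomm : A * X = X * A := by
    have hskew : (X * A - A * X)ᵀ = -(X * A - A * X) := by
      rw [Matrix.transpose_sub, Matrix.transpose_mul, Matrix.transpose_mul, hsymm.eq, hA.1.eq]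
      abel
    have htr : ∀ K : Matrix (Fin n) (Fin n) ℝ, Matrix.trace ((X * A - A * X) * K) = 0 := by
      intro K
      have h1 := hT K 0
      have h2 : Matrix.trace ((X * A - A * X) * Kᵀ) = -Matrix.trace ((X * A - A * X) * K) := by
        rw [← Matrix.trace_transpose, Matrix.transpose_mul, Matrix.transpose_transpose, hskew,
          Matrix.mul_neg, Matrix.trace_neg, Matrix.trace_mul_comm]
      have h3 : Matrix.trace (X * T (K, 0)) =
          Matrix.trace ((X * A - A * X) * K) - Matrix.trace ((X * A - A * X) * Kᵀ) := by
        have h4 : Matrix.trace (X * ((K - Kᵀ) * A)) = Matrix.trace (A * X * (K - Kᵀ)) := by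
          rw [← mul_assoc, Matrix.trace_mul_comm, mul_assoc]
        simp only [T, LinearMap.coe_mk, AddHom.coe_mk, Pi.zero_apply, zero_smul,
          Finset.sum_const_zero, add_zero]
        rw [mul_sub, Matrix.trace_sub, h4, ← Matrix.trace_sub, ← Matrix.trace_sub]
        congr 1
        noncomm_ring
      linarith
    have h0 : X * A - A * X = 0 :=
      Matrix.ext_iff_trace_mul_right.2 fun K => by rw [htr K]; simp
    exact (sub_eq_zero.1 h0).symm
  have hpow : ∀ k < qDist A, Matrix.trace (A ^ k * X) = 0 := fun k hk => by
    have h1 := hT 0 (Pi.single ⟨k, hk⟩ 1)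
    have h2 : T (0, Pi.single ⟨k, hk⟩ 1) = A ^ k := by
      simp [T, Pi.single_apply, ite_smul]
    rw [h2] at h1
    rw [Matrix.trace_mul_comm, h1]
  have hX0 : X = 0 := by
    refine hsmp X hsymm (fun i j => ?_) (fun i => hoff i i (by simp)) hcomm hpow
    rcases eq_or_ne i j with rfl | hij
    · rw [hoff i i (by simp), mul_zero]
    · by_cases hadj : G.Adj i j
      · rw [hoff i j (fun h => h.2 hadj), mul_zero]
      · rw [show A i j = 0 from by_contra fun h0 => hadj ((hA.2 i j hij).1 h0), zero_mul]
  apply hf0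
  ext z
  obtain ⟨M, rfl⟩ := (nonEdgePart G).surjective_rangeRestrict z
  have := hg M
  rw [hX0] at this
  simpa using this

theorem qDist_conj_diagonal {n : ℕ} (U V : Matrix (Fin n) (Fin n) ℝ) (h : V * U = 1)
    (d : Fin n → ℝ) :
    qDist (U * Matrix.diagonal d * V) = (Finset.univ.image d).card := by
  classical
  have h1 : (U * Matrix.diagonal d * V).charpoly = ∏ i, (X - C (d i)) := by
    rw [Matrix.charpoly_mul_comm, ← mul_assoc, h, one_mul, Matrix.charpoly_diagonal]
  have h2 : (∏ i, (X - C (d i))).roots = Finset.univ.val.map d := by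
    rw [Polynomial.roots_prod _ _ (by simp [Finset.prod_ne_zero_iff, Polynomial.X_sub_C_ne_zero])]
    simp
  rw [qDist, h1, h2]
  congr 1

theorem card_image_eq_succ {ι α : Type*} [Fintype ι] [DecidableEq ι] [DecidableEq α]
    {l d : ι → α} {i₀ i₁ : ι} (hne : i₀ ≠ i₁) (hl : l i₀ = l i₁) (hd : d i₀ ≠ d i₁)
    (h₁ : ∀ i j, l i ≠ l j → d i ≠ d j)
    (h₂ : ∀ i j, i ≠ i₀ → j ≠ i₀ → l i = l j → d i = d j) :
    (Finset.univ.image d).card = (Finset.univ.image l).card + 1 := by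
  have himl : (Finset.univ.erase i₀).image l = Finset.univ.image l := by
    ext x
    simp only [Finset.mem_image, Finset.mem_erase, Finset.mem_univ, and_true, true_and]
    constructor
    · rintro ⟨i, -, rfl⟩
      exact ⟨i, rfl⟩
    · rintro ⟨i, rfl⟩
      by_cases hi : i = i₀
      · exact ⟨i₁, hne.symm, by rw [hi, hl]⟩
      · exact ⟨i, hi, rfl⟩
  have hcard : ((Finset.univ.erase i₀).image d).card = ((Finset.univ.erase i₀).image l).card := by
    refine Finset.card_bij' (fun x hx => l (Finset.mem_image.1 hx).choose)
      (fun x hx => d (Finset.mem_image.1 hx).choose) ?_ ?_ ?_ ?_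
    · intro x hx
      exact Finset.mem_image_of_mem _ (Finset.mem_image.1 hx).choose_spec.1
    · intro x hx
      exact Finset.mem_image_of_mem _ (Finset.mem_image.1 hx).choose_spec.1
    · intro x hx
      have hx1 := (Finset.mem_image.1 hx).choose_spec
      have hy : l (Finset.mem_image.1 hx).choose ∈ (Finset.univ.erase i₀).image l :=
        Finset.mem_image_of_mem _ hx1.1
      have hy1 := (Finset.mem_image.1 hy).choose_spec
      exact (h₂ _ _ (Finset.ne_of_mem_erase hy1.1) (Finset.ne_of_mem_erase hx1.1) hy1.2).trans hx1.2
    · intro x hx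
      have hx1 := (Finset.mem_image.1 hx).choose_spec
      have hy : d (Finset.mem_image.1 hx).choose ∈ (Finset.univ.erase i₀).image d :=
        Finset.mem_image_of_mem _ hx1.1
      have hy1 := (Finset.mem_image.1 hy).choose_spec
      by_contra hcon
      exact h₁ _ _ (fun h => hcon (h.trans hx1.2)) hy1.2
  have hins : Finset.univ.image d = insert (d i₀) ((Finset.univ.erase i₀).image d) := by
    rw [← Finset.image_insert, Finset.insert_erase (Finset.mem_univ _)]
  rw [hins, Finset.card_insert_of_notMem, hcard, himl]
  simp only [Finset.mem_image, Finset.mem_erase, Finset.mem_univ, and_true, not_exists, not_and]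
  intro i hi hdi
  by_cases hli : l i = l i₀
  · exact hd ((hdi.symm).trans (h₂ _ _ hi hne.symm (hli.trans hl)))
  · exact h₁ _ _ hli hdi

/-- A conjugation-by-exponentials family can be moved onto the zero set of `P` while keeping the
transversal parameter `τ` nonzero, provided the linearization is onto. -/
theorem exists_conj_exp_eq_zero {E F 𝔸 : Type*} [NormedAddCommGroup E] [NormedSpace ℝ E]
    [CompleteSpace E] [NormedAddCommGroup F] [NormedSpace ℝ F] [CompleteSpace F] [NormedRing 𝔸]
    [NormedAlgebra ℝ 𝔸] [CompleteSpace 𝔸] (a : 𝔸) (S L : E →L[ℝ] 𝔸) (P : 𝔸 →L[ℝ] F)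
    (τ : E →L[ℝ] ℝ) (hPa : P a = 0)
    (hsurj : ∀ (y : F) (t : ℝ), ∃ x, P (a * S x - S x * a + L x) = y ∧ τ x = t)
    {p : E → Prop} {r : 𝔸 → Prop} (hp : ∀ᶠ x in 𝓝 0, p x) (hr : ∀ᶠ b in 𝓝 a, r b) :
    ∃ x, p x ∧ r (NormedSpace.exp (-S x) * (a + L x) * NormedSpace.exp (S x)) ∧
      P (NormedSpace.exp (-S x) * (a + L x) * NormedSpace.exp (S x)) = 0 ∧ τ x ≠ 0 := by
  have hexp : HasStrictFDerivAt (NormedSpace.exp : 𝔸 → 𝔸) (1 : 𝔸 →L[ℝ] 𝔸) (S 0) := by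
    rw [map_zero]
    exact hasStrictFDerivAt_exp_zero
  have hexp' : HasStrictFDerivAt (NormedSpace.exp : 𝔸 → 𝔸) (1 : 𝔸 →L[ℝ] 𝔸) ((-S) 0) := by
    rw [map_zero]
    exact hasStrictFDerivAt_exp_zero
  have h1 := hexp.comp (0 : E) S.hasStrictFDerivAt
  have h2 := hexp'.comp (0 : E) (-S).hasStrictFDerivAt
  have h3 := (L.hasStrictFDerivAt (x := (0 : E))).const_add a
  set M : E → 𝔸 := fun x => NormedSpace.exp (-S x) * (a + L x) * NormedSpace.exp (S x) with hM
  have hM0 : M 0 = a := by simp [hM]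
  have h4 : HasStrictFDerivAt M _ 0 := (h2.mul' h3).mul' h1
  have hrM : ∀ᶠ x in 𝓝 0, r (M x) := h4.continuousAt.eventually (by rwa [hM0])
  have h5 : HasStrictFDerivAt (fun x => (P (M x), τ x)) _ 0 :=
    (P.hasStrictFDerivAt.comp (0 : E) h4).prodMk (τ.hasStrictFDerivAt (x := (0 : E)))
  have hmap := h5.map_nhds_eq_of_surj (by
    rw [LinearMap.range_eq_top]
    rintro ⟨y, t⟩
    obtain ⟨x, hx, hxt⟩ := hsurj y t
    refine ⟨x, Prod.ext ?_ hxt⟩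
    rw [← hx]
    simp [sub_eq_add_neg, add_comm, add_left_comm])
  have himg := image_mem_map (m := fun x => (P (M x), τ x)) (hp.and hrM)
  rw [hmap, hM0, hPa, map_zero] at himg
  have hlim : Tendsto (fun t : ℝ => ((0 : F), t)) (𝓝[≠] 0) (𝓝 ((0 : F), (0 : ℝ))) :=
    ((by fun_prop : Continuous fun t : ℝ => ((0 : F), t)).tendsto' _ _ rfl).mono_left
      nhdsWithin_le_nhds
  obtain ⟨t, ⟨x, ⟨hpx, hrx⟩, hx⟩, ht⟩ :=
    ((hlim.eventually_mem himg).and self_mem_nhdsWithin).exists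
  refine ⟨x, hpx, hrx, congrArg Prod.fst hx, ?_⟩
  rw [show τ x = t from congrArg Prod.snd hx]
  exact ht

theorem exists_orthogonal_diagonalization {n : ℕ} {A : Matrix (Fin n) (Fin n) ℝ} (hA : A.IsSymm) :
    ∃ (V : Matrix (Fin n) (Fin n) ℝ) (l : Fin n → ℝ),
      Vᵀ * V = 1 ∧ A = V * Matrix.diagonal l * Vᵀ := by
  have hH : A.IsHermitian := by
    rw [Matrix.IsHermitian, Matrix.conjTranspose_eq_transpose_of_trivial, hA.eq]
  have hstar : star (hH.eigenvectorUnitary : Matrix (Fin n) (Fin n) ℝ) =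
      (hH.eigenvectorUnitary : Matrix (Fin n) (Fin n) ℝ)ᵀ := by
    rw [Matrix.star_eq_conjTranspose, Matrix.conjTranspose_eq_transpose_of_trivial]
  refine ⟨hH.eigenvectorUnitary, hH.eigenvalues, ?_, ?_⟩
  · rw [← hstar]
    exact Unitary.coe_star_mul_self _
  · have h := hH.spectral_theorem
    rw [Unitary.conjStarAlgAut_apply, hstar] at h
    exact h

theorem conj_diagonal_pow {n : ℕ} {U V : Matrix (Fin n) (Fin n) ℝ} (h : V * U = 1)
    (d : Fin n → ℝ) (k : ℕ) :
    (U * Matrix.diagonal d * V) ^ k = U * Matrix.diagonal (d ^ k) * V := by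
  have hUV : U * V = 1 := mul_eq_one_comm.1 h
  induction k with
  | zero => simp [hUV]
  | succ k ih =>
    rw [pow_succ, ih, pow_succ]
    calc U * Matrix.diagonal (d ^ k) * V * (U * Matrix.diagonal d * V)
        = U * Matrix.diagonal (d ^ k) * (V * U) * Matrix.diagonal d * V := by
          simp only [mul_assoc]
      _ = U * Matrix.diagonal (d ^ k * d) * V := by
          rw [h, mul_one, mul_assoc U, Matrix.diagonal_mul_diagonal]
          rfl

section Analytic

attribute [local instance] Matrix.linftyOpNormedRing Matrix.linftyOpNormedAlgebra

/-- Within the matrices with graph `G`, the strong multiplicity property persists under small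
perturbations that do not lower the number of distinct eigenvalues. -/
theorem HasSMP.eventually {n : ℕ} {G : SimpleGraph (Fin n)}
    {A : Matrix (Fin n) (Fin n) ℝ} (hA : sMem G A) (hsmp : HasSMP A) :
    ∀ᶠ B in 𝓝 A, sMem G B → qDist A ≤ qDist B → HasSMP B := by
  let T : Matrix (Fin n) (Fin n) ℝ → Matrix (Fin n) (Fin n) ℝ →L[ℝ]
      Matrix (Fin n) (Fin n) ℝ × Matrix (Fin n) (Fin n) ℝ × (Fin (qDist A) → ℝ) := fun B =>
    LinearMap.toContinuousLinearMap
      ((nonEdgePart G - (2 : ℝ) • LinearMap.id).prod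
        ((LinearMap.mulLeft ℝ B - LinearMap.mulRight ℝ B).prod
          (LinearMap.pi fun k =>
            Matrix.traceLinearMap (Fin n) ℝ ℝ ∘ₗ LinearMap.mulLeft ℝ (B ^ (k : ℕ)))))
  have hTapp : ∀ B X, T B X = (nonEdgePart G X - (2 : ℝ) • X, B * X - X * B,
      fun k : Fin (qDist A) => Matrix.trace (B ^ (k : ℕ) * X)) := fun B X => rfl
  have hT : Continuous T := by
    refine continuous_clm_apply.2 fun X => ?_
    refine Continuous.congr ?_ fun B => (hTapp B X).symm
    refine continuous_const.prodMk (Continuous.prodMk (by fun_prop) (continuous_pi fun k => ?_))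
    exact (LinearMap.continuous_of_finiteDimensional (Matrix.traceLinearMap (Fin n) ℝ ℝ)).comp
      (by fun_prop : Continuous fun B : Matrix (Fin n) (Fin n) ℝ => B ^ (k : ℕ) * X)
  have hinj : Function.Injective (T A) := by
    rw [injective_iff_map_eq_zero]
    intro X hX
    rw [hTapp, Prod.mk_eq_zero, Prod.mk_eq_zero, sub_eq_zero, sub_eq_zero] at hX
    exact (hasSMP_iff hA).1 hsmp X hX.1 hX.2.1 fun k hk => congrFun hX.2.2 ⟨k, hk⟩
  filter_upwards [hT.continuousAt.eventually
    (ContinuousLinearMap.isOpen_injective.mem_nhds hinj)] with B hB hBG hq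
  rw [hasSMP_iff hBG]
  intro X hX hcomm htr
  have hB' : Function.Injective (T B) := hB
  refine (injective_iff_map_eq_zero (T B)).1 hB' X ?_
  rw [hTapp, Prod.mk_eq_zero, Prod.mk_eq_zero, sub_eq_zero, sub_eq_zero]
  exact ⟨hX, hcomm, funext fun k => htr k (k.2.trans_le hq)⟩

theorem HasSMP.exists_qDist_succ {n : ℕ} {G : SimpleGraph (Fin n)}
    {A : Matrix (Fin n) (Fin n) ℝ} (hA : sMem G A) (hsmp : HasSMP A) (hlt : qDist A < n) :
    ∃ A' : Matrix (Fin n) (Fin n) ℝ, sMem G A' ∧ HasSMP A' ∧ qDist A' = qDist A + 1 := by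
  obtain ⟨V, l, hV, hAV⟩ := exists_orthogonal_diagonalization hA.1
  have hq : qDist A = (Finset.univ.image l).card := by
    rw [hAV, qDist_conj_diagonal V Vᵀ hV l]
  obtain ⟨i₀, i₁, hl, hne⟩ : ∃ i₀ i₁, l i₀ = l i₁ ∧ i₀ ≠ i₁ := by
    by_contra hcon
    have hinj : Function.Injective l := fun i j hij => by
      by_contra h
      exact hcon ⟨i, j, hij, h⟩
    rw [hq, Finset.card_image_of_injective _ hinj, Finset.card_univ, Fintype.card_fin] at hlt
    exact lt_irrefl _ hlt
  let D : Matrix (Fin n) (Fin n) ℝ × (Fin (qDist A) → ℝ) × ℝ →ₗ[ℝ] (Fin n → ℝ) :=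
    (Fintype.linearCombination ℝ (fun k : Fin (qDist A) => l ^ (k : ℕ))).coprod
      (LinearMap.single ℝ (fun _ => ℝ) i₀) ∘ₗ LinearMap.snd ℝ _ _
  have hDapp : ∀ x i, D x i =
      ∑ k, x.2.1 k * l i ^ (k : ℕ) + (Pi.single i₀ x.2.2 : Fin n → ℝ) i := fun x i => by
    simp [D, Fintype.linearCombination_apply]
  let L : Matrix (Fin n) (Fin n) ℝ × (Fin (qDist A) → ℝ) × ℝ →L[ℝ] Matrix (Fin n) (Fin n) ℝ :=
    LinearMap.toContinuousLinearMap
    (LinearMap.mulRight ℝ Vᵀ ∘ₗ LinearMap.mulLeft ℝ V ∘ₗ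
      Matrix.diagonalLinearMap (Fin n) ℝ ℝ ∘ₗ D)
  have hLapp : ∀ x, L x = V * Matrix.diagonal (D x) * Vᵀ := fun x => rfl
  let S : Matrix (Fin n) (Fin n) ℝ × (Fin (qDist A) → ℝ) × ℝ →L[ℝ] Matrix (Fin n) (Fin n) ℝ :=
    LinearMap.toContinuousLinearMap
    ((LinearMap.id - (Matrix.transposeLinearEquiv (Fin n) (Fin n) ℝ ℝ).toLinearMap) ∘ₗ
      LinearMap.fst ℝ _ _)
  have hSapp : ∀ x, S x = x.1 - x.1ᵀ := fun x => rfl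
  let P : Matrix (Fin n) (Fin n) ℝ →L[ℝ] LinearMap.range (nonEdgePart G) :=
    LinearMap.toContinuousLinearMap (nonEdgePart G).rangeRestrict
  have hPapp : ∀ M, P M = (nonEdgePart G).rangeRestrict M := fun M => rfl
  let τ : Matrix (Fin n) (Fin n) ℝ × (Fin (qDist A) → ℝ) × ℝ →L[ℝ] ℝ := (ContinuousLinearMap.snd ℝ _ _).comp (ContinuousLinearMap.snd ℝ _ _)
  have hτ : ∀ x, τ x = x.2.2 := fun x => rfl
  have hsurj : ∀ y t, ∃ x, P (A * S x - S x * A + L x) = y ∧ τ x = t := by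
    intro y t
    obtain ⟨K, c, hKc⟩ := hsmp.exists_nonEdgePart_eq hA
      (y - P (V * Matrix.diagonal (Pi.single i₀ t) * Vᵀ))
    refine ⟨(K, c, t), ?_, rfl⟩
    have hL : L (K, c, t) =
        ∑ k, c k • A ^ (k : ℕ) + V * Matrix.diagonal (Pi.single i₀ t) * Vᵀ := by
      have hsum : ∑ k, c k • A ^ (k : ℕ) =
          V * Matrix.diagonal (∑ k, c k • l ^ (k : ℕ)) * Vᵀ := by
        have hdiag : Matrix.diagonal (∑ k, c k • l ^ (k : ℕ)) =
            ∑ k, c k • Matrix.diagonal (l ^ (k : ℕ)) :=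
          (map_sum (Matrix.diagonalLinearMap (Fin n) ℝ ℝ) _ _).trans <|
            Finset.sum_congr rfl fun k _ => map_smul (Matrix.diagonalLinearMap (Fin n) ℝ ℝ) _ _
        rw [hdiag, Finset.mul_sum, Finset.sum_mul]
        refine Finset.sum_congr rfl fun k _ => ?_
        rw [Matrix.mul_smul, Matrix.smul_mul]
        congr 1
        exact (congrArg (· ^ (k : ℕ)) hAV).trans (conj_diagonal_pow hV l k)
      have hD : D (K, c, t) = ∑ k, c k • l ^ (k : ℕ) + Pi.single i₀ t := rfl
      rw [hLapp, hsum, hD, ← add_mul, ← mul_add, Matrix.diagonal_add]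
      rfl
    rw [hL, hSapp, ← add_assoc, map_add, hPapp, hKc, sub_add_cancel]
  have hp : ∀ᶠ x in 𝓝 0, ∀ i j, l i ≠ l j → (l + D x) i ≠ (l + D x) j := by
    have hDc : Continuous D := LinearMap.continuous_of_finiteDimensional D
    have hc : ∀ i, Continuous fun x => (l + D x) i := fun i =>
      (continuous_apply i).comp (continuous_const.add hDc)
    refine eventually_all.2 fun i => eventually_all.2 fun j => ?_
    by_cases hij : l i = l j
    · simp [hij]
    · have : (l + D 0) i ≠ (l + D 0) j := by simpa using hij
      filter_upwards [(isOpen_ne_fun (hc i) (hc j)).mem_nhds this] with x hx _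
      exact hx
  have hr : ∀ᶠ B in 𝓝 A, (∀ i j, G.Adj i j → B i j ≠ 0) ∧
      (sMem G B → qDist A ≤ qDist B → HasSMP B) := by
    refine Eventually.and ?_ (hsmp.eventually hA)
    refine eventually_all.2 fun i => eventually_all.2 fun j => ?_
    by_cases hij : G.Adj i j
    · have hc : Continuous fun B : Matrix (Fin n) (Fin n) ℝ => B i j :=
        LinearMap.continuous_of_finiteDimensional (Matrix.entryLinearMap ℝ ℝ i j)
      filter_upwards [hc.continuousAt.eventually_ne ((hA.2 i j hij.ne).2 hij)] with B hB _
      exact hB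
    · simp [hij]
  obtain ⟨x, hpx, ⟨hadj, hsmpM⟩, hPM, hτx⟩ := exists_conj_exp_eq_zero A S L P τ
    (Subtype.ext (nonEdgePart_eq_zero_of_sMem hA)) hsurj hp hr
  have hexp : NormedSpace.exp (S x) * NormedSpace.exp (-S x) = 1 := by
    rw [Matrix.exp_neg]
    exact Matrix.mul_nonsing_inv _ ((Matrix.isUnit_iff_isUnit_det _).1 (Matrix.isUnit_exp _))
  have hskew : (S x)ᵀ = -S x := by
    rw [hSapp, Matrix.transpose_sub, Matrix.transpose_transpose, neg_sub]
  have hAL : A + L x = V * Matrix.diagonal (l + D x) * Vᵀ := by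
    refine (congrArg (· + L x) hAV).trans ?_
    simp only [hLapp]
    rw [← add_mul, ← mul_add, Matrix.diagonal_add]
    rfl
  set M := NormedSpace.exp (-S x) * (A + L x) * NormedSpace.exp (S x) with hM
  have hMdiag : M = (NormedSpace.exp (-S x) * V) * Matrix.diagonal (l + D x) *
      (Vᵀ * NormedSpace.exp (S x)) := by
    rw [hM, hAL]
    simp only [mul_assoc]
  have hMsymm : M.IsSymm := by
    rw [Matrix.IsSymm, hMdiag]
    simp only [Matrix.transpose_mul, ← Matrix.exp_transpose, Matrix.transpose_neg, hskew, neg_neg,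
      Matrix.diagonal_transpose, Matrix.transpose_transpose, mul_assoc]
  have hMG : sMem G M := by
    refine ⟨hMsymm, fun i j hij => ⟨fun h => ?_, hadj i j⟩⟩
    by_contra h0
    exact h (eq_zero_of_nonEdgePart_eq_zero hMsymm (congrArg Subtype.val hPM) hij h0)
  have hqM : qDist M = qDist A + 1 := by
    have hVU : Vᵀ * NormedSpace.exp (S x) * (NormedSpace.exp (-S x) * V) = 1 := by
      rw [mul_assoc, ← mul_assoc (NormedSpace.exp (S x)), hexp, one_mul, hV]
    rw [hMdiag, qDist_conj_diagonal _ _ hVU]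
    refine (card_image_eq_succ hne hl ?_ hpx ?_).trans (by rw [hq])
    · simp only [Pi.add_apply, hDapp, hl, Pi.single_eq_same, Pi.single_eq_of_ne hne.symm]
      intro h
      refine hτx ((hτ x).trans ?_)
      linarith
    · intro i j hi hj hij
      simp only [Pi.add_apply, hDapp, hij, Pi.single_eq_of_ne hi, Pi.single_eq_of_ne hj]
  exact ⟨M, hMG, hsmpM hMG ((Nat.le_succ _).trans hqM.ge), hqM⟩

end Analytic

/-- Theorem 9 (SMP case): if `A ∈ S(G)` has the SMP, then every number of distinct
eigenvalues `q'` with `q(A) ≤ q' ≤ n` is realized by a matrix in `S(G)` with the SMP. -/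
theorem q_increment_smp (n : ℕ) (G : SimpleGraph (Fin n))
    (A : Matrix (Fin n) (Fin n) ℝ) (hA : sMem G A) (hsmp : HasSMP A) :
    ∀ q' : ℕ, qDist A ≤ q' → q' ≤ n →
      ∃ A' : Matrix (Fin n) (Fin n) ℝ, sMem G A' ∧ HasSMP A' ∧ qDist A' = q' := by
  intro q' hq
  induction q', hq using Nat.le_induction with
  | base => exact fun _ => ⟨A, hA, hsmp, rfl⟩
  | succ q' _ ih =>
    intro hn
    obtain ⟨B, hB, hBs, hBq⟩ := ih (by omega)
    rw [← hBq]
    exact hBs.exists_qDist_succ hB (by omega)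
end

section
/- Let P be an n×n sign pattern. If there is a nilpotent matrix A ∈ Q(P) with the non-symmetric strong spectral property (nSSP), then there is a nilpotent matrix A' ∈ Q(P) of nilpotency index n (i.e., (A')ⁿ = O and (A')^{n−1} ≠ O) that has the nSSP. -/
open Matrix Polynomial

/-- `A` belongs to the qualitative class `Q(P)` of the sign pattern `P`. -/
def qMem {n : ℕ} (P : Fin n → Fin n → SignType) (A : Matrix (Fin n) (Fin n) ℝ) : Prop :=
  ∀ i j, SignType.sign (A i j) = P i j

/-- The non-symmetric strong spectral property. -/
def HasNSSP {n : ℕ} (A : Matrix (Fin n) (Fin n) ℝ) : Prop :=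
  ∀ X : Matrix (Fin n) (Fin n) ℝ,
    (∀ i j, A i j * X i j = 0) → A * Xᵀ = Xᵀ * A → X = 0

/-- On an `(n + 1)`-dimensional space every nilpotent endomorphism lies on a line of nilpotent
endomorphisms whose direction has nilpotency index `n + 1`. -/
theorem exists_nilpotent_pencil {K : Type*} [Field K] (n : ℕ) :
    ∀ (V : Type*) [AddCommGroup V] [Module K V] [FiniteDimensional K V],
      Module.finrank K V = n + 1 → ∀ f : Module.End K V, IsNilpotent f →
      ∃ J : Module.End K V, J ^ n ≠ 0 ∧ ∀ t : K, (f + t • J) ^ (n + 1) = 0 := by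
  induction n with
  | zero =>
    intro V _ _ _ hV f hf
    have : Nontrivial V := Module.nontrivial_of_finrank_pos (R := K) (by omega)
    refine ⟨0, by simp, fun t => ?_⟩
    have h2 := LinearMap.aeval_self_charpoly f
    rw [hf.charpoly_eq_X_pow_finrank, hV] at h2
    simpa using h2
  | succ n ih =>
    intro V _ _ _ hV f hf
    have : Nontrivial V := Module.nontrivial_of_finrank_pos (R := K) (by omega)
    have hlt : LinearMap.range f < ⊤ := by
      rw [lt_top_iff_ne_top]
      intro h
      obtain ⟨k, hk⟩ := hf
      have hs : Function.Surjective (f ^ k) := by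
        rw [Module.End.coe_pow]
        exact (LinearMap.range_eq_top.1 h).iterate k
      obtain ⟨x, hx⟩ := exists_ne (0 : V)
      obtain ⟨y, hy⟩ := hs x
      exact hx (by rw [← hy, hk, LinearMap.zero_apply])
    obtain ⟨φ, hφ, hle⟩ := Submodule.exists_le_ker_of_lt_top _ hlt
    have hW : Module.finrank K (LinearMap.ker φ) = n + 1 := by
      have := Module.Dual.finrank_ker_add_one_of_ne_zero hφ
      omega
    obtain ⟨e, he⟩ := LinearMap.surjective hφ 1
    have hfW : ∀ x, f x ∈ LinearMap.ker φ := fun x => hle ⟨x, rfl⟩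
    let fW : Module.End K (LinearMap.ker φ) := f.restrict (fun x _ => hfW x)
    have hfWn : IsNilpotent fW := by
      obtain ⟨k, hk⟩ := hf
      refine ⟨k, ?_⟩
      ext x
      simp [fW, Module.End.pow_restrict, hk]
    obtain ⟨JW, hJ, hpow⟩ := ih (LinearMap.ker φ) hW fW hfWn
    obtain ⟨w, hw⟩ : ∃ w, (JW ^ n) w ≠ 0 := by
      by_contra! h
      exact hJ (LinearMap.ext h)
    let p : V →ₗ[K] LinearMap.ker φ :=
      LinearMap.codRestrict _ (LinearMap.id - φ.smulRight e) (fun x => by simp [he])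
    let J : Module.End K V := (LinearMap.ker φ).subtype ∘ₗ (JW ∘ₗ p + φ.smulRight w)
    have hpv : ∀ v, (p v : V) = v - φ v • e := fun v => rfl
    have hp : ∀ x : LinearMap.ker φ, p x = x := fun x => by
      rw [← Subtype.val_inj, hpv, LinearMap.mem_ker.1 x.2, zero_smul, sub_zero]
    have hpe : p e = 0 := by
      rw [← Subtype.val_inj, hpv, he, one_smul, sub_self, Submodule.coe_zero]
    have hJW : ∀ x : LinearMap.ker φ, J x = JW x := fun x => by
      simp [J, hp, LinearMap.mem_ker.1 x.2]
    have hJe : J e = w := by simp [J, hpe, he]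
    have hiter : ∀ (g : Module.End K V) (gW : Module.End K (LinearMap.ker φ)),
        (∀ x : LinearMap.ker φ, g x = gW x) →
        ∀ (k : ℕ) (x : LinearMap.ker φ), (g ^ k) x = (gW ^ k) x := by
      intro g gW h k
      induction k with
      | zero => simp
      | succ k ihk => intro x; rw [pow_succ, pow_succ, Module.End.mul_apply, h, ihk]; rfl
    refine ⟨J, fun h => hw ?_, fun t => ?_⟩
    · have h2 : (J ^ (n + 1)) e = 0 := by rw [h]; rfl
      rw [pow_succ, Module.End.mul_apply, hJe, hiter J JW hJW] at h2
      exact_mod_cast h2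
    · ext x
      have hx : (f + t • J) x ∈ LinearMap.ker φ := by
        rw [LinearMap.add_apply, LinearMap.smul_apply]
        exact add_mem (hfW x) (Submodule.smul_mem _ _ (SetLike.coe_mem ((JW ∘ₗ p + φ.smulRight w) x)))
      have h2 := hiter (f + t • J) (fW + t • JW) (fun y => by simp [hJW, fW]) (n + 1) ⟨_, hx⟩
      rw [hpow t] at h2
      rw [pow_succ, Module.End.mul_apply]
      exact h2

open NormedSpace in
/-- The derivative at the origin of conjugation by an exponential. -/
theorem exists_hasStrictFDerivAt_exp_conj {E : Type*} [NormedRing E] [NormedAlgebra ℝ E]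
    [CompleteSpace E] (a : E) (h : E →L[ℝ] E) :
    ∃ D : E × E →L[ℝ] E,
      HasStrictFDerivAt (fun p : E × E => exp p.2 * (a + h p.1) * exp (-p.2)) D 0 ∧
      ∀ p, D p = h p.1 + (p.2 * a - a * p.2) := by
  have hexp : HasStrictFDerivAt (fun p : E × E => exp p.2) (ContinuousLinearMap.snd ℝ E E) 0 :=
    HasStrictFDerivAt.comp (g := exp) (g' := (1 : E →L[ℝ] E)) (0 : E × E)
      (hasStrictFDerivAt_exp_zero (𝕂 := ℝ)) hasStrictFDerivAt_snd
  have hexpn : HasStrictFDerivAt (fun p : E × E => exp (-p.2))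
      (-ContinuousLinearMap.snd ℝ E E) 0 := by
    refine HasStrictFDerivAt.comp (g := exp) (g' := (1 : E →L[ℝ] E)) (f := fun p : E × E => -p.2)
      (0 : E × E) ?_ hasStrictFDerivAt_snd.neg
    simpa using hasStrictFDerivAt_exp_zero (𝕂 := ℝ) (𝔸 := E)
  have hh : HasStrictFDerivAt (fun p : E × E => a + h p.1)
      (h ∘L ContinuousLinearMap.fst ℝ E E) 0 :=
    ((h ∘L ContinuousLinearMap.fst ℝ E E).hasStrictFDerivAt).const_add a
  refine ⟨_, (hexp.mul' hh).mul' hexpn, fun p => ?_⟩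
  simp
  abel

section Topology

attribute [local instance] Matrix.linftyOpNormedRing Matrix.linftyOpNormedAlgebra

variable {m : ℕ}

/-- Nilpotent matrices of maximal index are dense among nilpotent matrices. -/
theorem frequently_nilpotent_index (A : Matrix (Fin (m + 1)) (Fin (m + 1)) ℝ)
    (hA : IsNilpotent A) :
    ∃ᶠ M in nhds A, M ^ (m + 1) = 0 ∧ M ^ m ≠ 0 := by
  obtain ⟨J', hJ', hpow'⟩ := exists_nilpotent_pencil (K := ℝ) m (Fin (m + 1) → ℝ) (by simp)
    (Matrix.toLinAlgEquiv' A) (hA.map _)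
  obtain ⟨J, rfl⟩ := (Matrix.toLinAlgEquiv' (R := ℝ) (n := Fin (m + 1))).surjective J'
  have hJ : J ^ m ≠ 0 := by
    rintro h
    rw [← map_pow, h, map_zero] at hJ'
    exact hJ' rfl
  have hpow : ∀ t : ℝ, (A + t • J) ^ (m + 1) = 0 := fun t => by
    have h := hpow' t
    rw [← map_smul, ← map_add, ← map_pow] at h
    exact (map_eq_zero_iff _ (AlgEquiv.injective _)).1 h
  have hcont : Filter.Tendsto (fun t : ℝ => A + t • J) (nhds 0) (nhds A) := by
    have : Continuous (fun t : ℝ => A + t • J) := by fun_prop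
    simpa using this.tendsto 0
  refine hcont.frequently (p := fun M => M ^ (m + 1) = 0 ∧ M ^ m ≠ 0) ?_
  simp only [hpow, true_and]
  intro hev
  simp only [not_not] at hev
  have han : AnalyticOnNhd ℝ (fun t : ℝ => (A + t • J) ^ m) Set.univ := fun t _ => by fun_prop
  have hzero := han.eq_of_eventuallyEq (g := fun _ => 0) (fun t _ => analyticAt_const) hev
  have hs : ∀ s : ℝ, s ≠ 0 → (s • A + J) ^ m = 0 := fun s hs => by
    have h := congrFun hzero s⁻¹
    have h2 : s • A + J = s • (A + s⁻¹ • J) := by rw [smul_add, smul_inv_smul₀ hs]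
    rw [h2, _root_.smul_pow]
    rw [h, smul_zero]
  have hc : Continuous (fun s : ℝ => (s • A + J) ^ m) := by fun_prop
  have hlim : Filter.Tendsto (fun s : ℝ => (s • A + J) ^ m) (nhdsWithin 0 {0}ᶜ) (nhds (J ^ m)) := by
    simpa using (hc.tendsto 0).mono_left nhdsWithin_le_nhds
  refine hJ (tendsto_nhds_unique hlim (tendsto_const_nhds.congr' ?_))
  filter_upwards [self_mem_nhdsWithin] with s h
  exact (hs s h).symm

/-- The linear map whose injectivity expresses the nSSP, as a function of the matrix. -/
noncomputable def nsspMap :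
    Matrix (Fin m) (Fin m) ℝ →ₗ[ℝ] Matrix (Fin m) (Fin m) ℝ →ₗ[ℝ]
      Matrix (Fin m) (Fin m) ℝ × Matrix (Fin m) (Fin m) ℝ :=
  LinearMap.mk₂ ℝ (fun B X => (B ⊙ X, B * Xᵀ - Xᵀ * B))
    (fun B B' X => by
      ext : 1 <;> simp [Matrix.add_hadamard, add_mul, mul_add]
      abel)
    (fun c B X => by simp [smul_sub])
    (fun B X X' => by
      ext : 1 <;> simp [Matrix.hadamard_add, add_mul, mul_add]
      abel)
    (fun c B X => by simp [smul_sub])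

theorem hasNSSP_iff (A : Matrix (Fin m) (Fin m) ℝ) :
    HasNSSP A ↔ Function.Injective (nsspMap A) := by
  rw [injective_iff_map_eq_zero]
  refine forall_congr' fun X => ?_
  simp only [nsspMap, LinearMap.mk₂_apply, Prod.mk_eq_zero, sub_eq_zero, and_imp]
  rw [← Matrix.ext_iff (M := A ⊙ X)]
  rfl

theorem isOpen_hasNSSP : IsOpen {A : Matrix (Fin m) (Fin m) ℝ | HasNSSP A} := by
  let T := LinearMap.toContinuousLinearMap.toLinearMap ∘ₗ nsspMap (m := m)
  have hT : Continuous T := T.continuous_of_finiteDimensional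
  have h : {A : Matrix (Fin m) (Fin m) ℝ | HasNSSP A} = T ⁻¹' {L | Function.Injective L} := by
    ext A
    exact hasNSSP_iff A
  rw [h]
  exact ContinuousLinearMap.isOpen_injective.preimage hT

/-- The nSSP says that the pattern space and the tangent space of the similarity orbit together
span the space of matrices. -/
theorem HasNSSP.exists_eq {A : Matrix (Fin m) (Fin m) ℝ} (hA : HasNSSP A)
    (M : Matrix (Fin m) (Fin m) ℝ) :
    ∃ H L : Matrix (Fin m) (Fin m) ℝ, A ⊙ H + (L * A - A * L) = M := by
  let D : Matrix (Fin m) (Fin m) ℝ × Matrix (Fin m) (Fin m) ℝ →ₗ[ℝ] Matrix (Fin m) (Fin m) ℝ :=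
    { toFun := fun p => A ⊙ p.1 + (p.2 * A - A * p.2)
      map_add' := fun p q => by
        simp only [Prod.fst_add, Prod.snd_add, Matrix.hadamard_add, add_mul, mul_add]
        abel
      map_smul' := fun c p => by simp [smul_sub, smul_add] }
  suffices h : LinearMap.range D = ⊤ by
    obtain ⟨p, hp⟩ := LinearMap.range_eq_top.1 h M
    exact ⟨p.1, p.2, hp⟩
  by_contra hne
  obtain ⟨f, hf, hle⟩ := Submodule.exists_le_ker_of_lt_top _ (lt_top_iff_ne_top.2 hne)
  have hfD : ∀ H L, f (A ⊙ H + (L * A - A * L)) = 0 := fun H L => hle ⟨(H, L), rfl⟩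
  let Y : Matrix (Fin m) (Fin m) ℝ := Matrix.of fun i j => f (Matrix.single i j 1)
  have hsingle : ∀ (i j : Fin m) (c : ℝ), f (Matrix.single i j c) = c * (Y i j) := fun i j c => by
    rw [← mul_one c, ← smul_eq_mul, ← Matrix.smul_single, map_smul]
    simp [Y]
  have hfY : ∀ N, f N = Matrix.trace (Yᵀ * N) := fun N => by
    conv_lhs => rw [Matrix.matrix_eq_sum_single N]
    simp only [map_sum, hsingle, Matrix.trace, Matrix.diag, Matrix.mul_apply, Matrix.transpose_apply]
    rw [Finset.sum_comm]
    simp only [mul_comm]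
  have hY : Y = 0 := by
    refine hA Y (fun i j => ?_) ?_
    · have h := hfD (Matrix.single i j 1) 0
      have h2 : A ⊙ Matrix.single i j 1 = Matrix.single i j (A i j) := by
        ext k l
        by_cases hk : i = k <;> by_cases hl : j = l <;> simp [Matrix.single, hk, hl]
      simpa [h2, hsingle] using h
    · rw [Matrix.ext_iff_trace_mul_right]
      intro L
      have h := hfD 0 L
      rw [Matrix.hadamard_zero, zero_add, hfY, mul_sub, Matrix.trace_sub, sub_eq_zero,
        ← mul_assoc, Matrix.trace_mul_comm, ← mul_assoc, ← mul_assoc] at h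
      exact h
  refine hf (LinearMap.ext fun N => ?_)
  simp [hfY, hY]

open NormedSpace in
/-- If `A` has the nSSP, every matrix near `A` is similar to a matrix near `A` with the same zero
pattern. -/
theorem HasNSSP.map_conj_nhds {A : Matrix (Fin m) (Fin m) ℝ} (hA : HasNSSP A) :
    Filter.map (fun p : Matrix (Fin m) (Fin m) ℝ × Matrix (Fin m) (Fin m) ℝ =>
      exp p.2 * (A + A ⊙ p.1) * exp (-p.2)) (nhds 0) = nhds A := by
  obtain ⟨D, hD, hDp⟩ := exists_hasStrictFDerivAt_exp_conj A (LinearMap.toContinuousLinearMap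
    { toFun := fun H => A ⊙ H
      map_add' := fun _ _ => Matrix.hadamard_add _ _ _
      map_smul' := fun _ _ => Matrix.hadamard_smul _ _ _ })
  have h := hD.map_nhds_eq_of_surj (by
    rw [LinearMap.range_eq_top]
    intro M
    obtain ⟨H, L, rfl⟩ := hA.exists_eq M
    exact ⟨(H, L), hDp (H, L)⟩)
  simp only [Prod.fst_zero, Prod.snd_zero, map_zero, add_zero, neg_zero, exp_zero, one_mul,
    mul_one] at h
  exact h

end Topology

theorem eventually_qMem {n : ℕ} {P : Fin n → Fin n → SignType} {A : Matrix (Fin n) (Fin n) ℝ}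
    (hA : qMem P A) : ∀ᶠ H in nhds (0 : Matrix (Fin n) (Fin n) ℝ), qMem P (A + A ⊙ H) := by
  simp only [qMem, Filter.eventually_all]
  intro i j
  have hc : Continuous (fun H : Matrix (Fin n) (Fin n) ℝ => 1 + H i j) := by fun_prop
  filter_upwards [hc.continuousAt.eventually (lt_mem_nhds (a := 0) (by simp))] with H hH
  rw [← hA i j, Matrix.add_apply, Matrix.hadamard_apply,
    show A i j + A i j * H i j = A i j * (1 + H i j) by ring, sign_mul, sign_pos hH, mul_one]

/-- Corollary 19: if `Q(P)` contains a nilpotent matrix with the nSSP, then it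
contains a nilpotent matrix of nilpotency index `n` with the nSSP. -/
theorem nilpotent_index_n (n : ℕ) (hn : 0 < n) (P : Fin n → Fin n → SignType)
    (A : Matrix (Fin n) (Fin n) ℝ) (hA : qMem P A)
    (hnil : IsNilpotent A) (hnssp : HasNSSP A) :
    ∃ A' : Matrix (Fin n) (Fin n) ℝ, qMem P A' ∧ HasNSSP A' ∧
      A' ^ n = 0 ∧ A' ^ (n - 1) ≠ 0 := by
  obtain ⟨m, rfl⟩ : ∃ m, n = m + 1 := ⟨n - 1, by omega⟩
  have hc : Continuous fun H : Matrix (Fin (m + 1)) (Fin (m + 1)) ℝ => A + A ⊙ H :=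
    continuous_const.add (continuous_matrix fun i j => by simp only [Matrix.hadamard_apply]; fun_prop)
  have hopen : ∀ᶠ H in nhds (0 : Matrix (Fin (m + 1)) (Fin (m + 1)) ℝ), HasNSSP (A + A ⊙ H) :=
    hc.continuousAt.eventually (isOpen_hasNSSP.mem_nhds (by simpa using hnssp))
  have hgood := (continuous_fst.tendsto (0 : Matrix (Fin (m + 1)) (Fin (m + 1)) ℝ ×
    Matrix (Fin (m + 1)) (Fin (m + 1)) ℝ)).eventually ((eventually_qMem hA).and hopen)
  have hfreq := frequently_nilpotent_index A hnil
  rw [← hnssp.map_conj_nhds, Filter.frequently_map] at hfreq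
  obtain ⟨p, ⟨hz, hnz⟩, hq, hs⟩ := (hfreq.and_eventually hgood).exists
  have hinv : NormedSpace.exp p.2 * NormedSpace.exp (-p.2) = 1 := by
    rw [← Matrix.exp_add_of_commute _ _ ((Commute.refl p.2).neg_right), add_neg_cancel,
      NormedSpace.exp_zero]
  let u : (Matrix (Fin (m + 1)) (Fin (m + 1)) ℝ)ˣ :=
    ⟨NormedSpace.exp p.2, NormedSpace.exp (-p.2), hinv, mul_eq_one_comm.1 hinv⟩
  have hconj : ∀ k, (NormedSpace.exp p.2 * (A + A ⊙ p.1) * NormedSpace.exp (-p.2)) ^ k =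
      u.val * (A + A ⊙ p.1) ^ k * u⁻¹.val := fun k => u.conj_pow _ k
  rw [hconj] at hz hnz
  refine ⟨A + A ⊙ p.1, hq, hs, ?_, fun h => hnz ?_⟩
  · exact (Units.mul_right_eq_zero u).1 ((Units.mul_left_eq_zero u⁻¹).1 hz)
  · simp only [Nat.add_sub_cancel] at h
    simp [h]
end
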